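/- Every centred permutation can be written as a box-sum π° = σ₁° ⊞ σ₂° ⊞ … ⊞ σ_n° of ⊞-indecomposable centred permutations, and this decomposition is unique up to transpositions of adjacent factors that form commuting pairs (pairs of one-quadrant permutations from opposite quadrants); in particular the number of factors and the multiset of factors are uniquely determined. -/

import Mathlib

/-- A *centred permutation*: `vals` is the one-line notation of the filled-in
permutation (length `n+1`), `origin` the index of the origin point. -/
structure CPerm where
  vals : List ℕ
  origin : ℕ
deriving DecidableEq

namespace CPerm

/-- Length of a centred permutation (origin does not count). -/
def len (p : CPerm) : ℕ := p.vals.length - 1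

/-- A genuine centred permutation: one-line notation is a permutation of
`{0, …, N-1}` and the origin index is in range. -/
def IsValid (p : CPerm) : Prop :=
  p.vals ≠ [] ∧ p.origin < p.vals.length ∧ p.vals.Perm (List.range p.vals.length)

def valAt (p : CPerm) (i : ℕ) : ℕ := p.vals.getD i 0

def originVal (p : CPerm) : ℕ := p.valAt p.origin

/-- The box-sum `p ⊞ q`: inflate the origin of `q` by a copy of `p`. -/
def boxSum (p q : CPerm) : CPerm :=
  let N := p.vals.length
  let v := q.originVal
  let shift : ℕ → ℕ := fun u => if u < v then u else u + (N - 1)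
  ⟨(q.vals.take q.origin).map shift ++ p.vals.map (· + v) ++
      (q.vals.drop (q.origin + 1)).map shift,
    q.origin + p.origin⟩

/-- The trivial centred permutation (origin only, length 0). -/
def trivial : CPerm := ⟨[0], 0⟩

/-- Iterated box-sum `σ₁ ⊞ σ₂ ⊞ ⋯ ⊞ σₙ`. -/
def boxSumList (l : List CPerm) : CPerm := l.foldr boxSum trivial

/-- `p` is ⊞-indecomposable: nonempty and not a box-sum of two strictly smaller
centred permutations. -/
def BoxIndecomposable (p : CPerm) : Prop :=
  1 ≤ p.len ∧
    ¬∃ a b : CPerm, a.IsValid ∧ b.IsValid ∧ 1 ≤ a.len ∧ 1 ≤ b.len ∧ boxSum a b = p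

/-- The non-origin point at index `i` of `p` lies in quadrant `q` (1–4,
numbered anticlockwise). -/
def InQuadrant (p : CPerm) (q : ℕ) (i : ℕ) : Prop :=
  i < p.vals.length ∧ i ≠ p.origin ∧
    ((q = 1 ∧ p.origin < i ∧ p.originVal < p.valAt i) ∨
     (q = 2 ∧ i < p.origin ∧ p.originVal < p.valAt i) ∨
     (q = 3 ∧ i < p.origin ∧ p.valAt i < p.originVal) ∨
     (q = 4 ∧ p.origin < i ∧ p.valAt i < p.originVal))

/-- All non-origin points of `p` lie in quadrant `q`. -/
def OneQuadrant (p : CPerm) (q : ℕ) : Prop :=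
  ∀ i, i < p.vals.length → i ≠ p.origin → InQuadrant p q i

def OppositeQuadrants (q₁ q₂ : ℕ) : Prop :=
  (q₁ = 1 ∧ q₂ = 3) ∨ (q₁ = 3 ∧ q₂ = 1) ∨ (q₁ = 2 ∧ q₂ = 4) ∨ (q₁ = 4 ∧ q₂ = 2)

/-- Centred pattern containment `p ≤ q` (origins must match up). -/
def PatternLE (p q : CPerm) : Prop :=
  ∃ f : ℕ → ℕ,
    (∀ i j, i < p.vals.length → j < p.vals.length → i < j → f i < f j) ∧
    (∀ i, i < p.vals.length → f i < q.vals.length) ∧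
    f p.origin = q.origin ∧
    (∀ i j, i < p.vals.length → j < p.vals.length →
      (p.valAt i < p.valAt j ↔ q.valAt (f i) < q.valAt (f j)))

/-- A centred permutation class: nonempty, consisting of valid centred
permutations, and downward closed under centred containment. -/
def IsClass (S : Set CPerm) : Prop :=
  S.Nonempty ∧ (∀ p ∈ S, p.IsValid) ∧
    ∀ p q : CPerm, q ∈ S → p.IsValid → PatternLE p q → p ∈ S

/-- `S` is closed under the box-sum. -/
def BoxClosed (S : Set CPerm) : Prop := ∀ p ∈ S, ∀ q ∈ S, boxSum p q ∈ S

/-- Number of centred permutations of length `n` in `S`. -/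
noncomputable def count (S : Set CPerm) (n : ℕ) : ℕ := {p | p ∈ S ∧ p.len = n}.ncard

/-- The single-point centred permutation in quadrant `q`. -/
def mu : ℕ → CPerm
  | 1 => ⟨[0, 1], 0⟩
  | 2 => ⟨[1, 0], 1⟩
  | 3 => ⟨[0, 1], 1⟩
  | 4 => ⟨[1, 0], 0⟩
  | _ => ⟨[0], 0⟩

def AdjacentQuadrants (a b : ℕ) : Prop :=
  (a, b) = (1, 2) ∨ (a, b) = (2, 3) ∨ (a, b) = (3, 4) ∨ (a, b) = (4, 1) ∨
  (a, b) = (2, 1) ∨ (a, b) = (3, 2) ∨ (a, b) = (4, 3) ∨ (a, b) = (1, 4)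

/-- The adjacency condition on a centred class. -/
def AdjacencyCondition (S : Set CPerm) : Prop :=
  (∃! q : ℕ, q ∈ ({1, 2, 3, 4} : Set ℕ) ∧ mu q ∈ S) ∨
    ∃ a b : ℕ, AdjacentQuadrants a b ∧ mu a ∈ S ∧ mu b ∈ S

end CPerm

namespace CPerm

/-- A commuting pair: one-quadrant permutations from opposite quadrants. -/
def CommutingPair (a b : CPerm) : Prop :=
  ∃ q₁ q₂ : ℕ, OppositeQuadrants q₁ q₂ ∧ OneQuadrant a q₁ ∧ OneQuadrant b q₂

/-- Transposition of an adjacent commuting pair in a list of factors. -/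
def CommStep (l l' : List CPerm) : Prop :=
  ∃ (pre post : List CPerm) (a b : CPerm), CommutingPair a b ∧
    l = pre ++ a :: b :: post ∧ l' = pre ++ b :: a :: post

end CPerm

namespace CPerm

/-- Pointwise form of validity. -/
structure Good (p : CPerm) : Prop where
  org : p.origin < p.vals.length
  lt : ∀ i, i < p.vals.length → p.valAt i < p.vals.length
  inj : ∀ i j, i < p.vals.length → j < p.vals.length → p.valAt i = p.valAt j → i = j

lemma valAt_eq (p : CPerm) (i : ℕ) (h : i < p.vals.length) : p.valAt i = p.vals[i] := by
  simp [valAt, List.getD_eq_getElem?_getD, h]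

lemma good_iff (p : CPerm) : p.IsValid ↔ p.Good := by
  constructor
  · rintro ⟨h0, h1, h2⟩
    have hn : p.vals.Nodup := h2.nodup_iff.mpr List.nodup_range
    refine ⟨h1, ?_, ?_⟩
    · intro i hi
      rw [valAt_eq p i hi]
      have := h2.mem_iff.mp (List.getElem_mem hi)
      simpa using this
    · intro i j hi hj h
      rw [valAt_eq p i hi, valAt_eq p j hj] at h
      exact (hn.getElem_inj_iff).mp h
  · rintro ⟨h1, h2, h3⟩
    have hn : p.vals.Nodup := by
      rw [List.nodup_iff_injective_getElem]
      intro i j h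
      have := h3 i j i.2 j.2 (by rw [valAt_eq p i i.2, valAt_eq p j j.2]; exact h)
      exact Fin.ext this
    refine ⟨?_, h1, ?_⟩
    · intro h; rw [h] at h1; simp at h1
    · have hsub : p.vals ⊆ List.range p.vals.length := by
        intro x hx
        obtain ⟨i, hi, rfl⟩ := List.getElem_of_mem hx
        have := h2 i hi
        rw [valAt_eq p i hi] at this
        simpa using this
      exact (hn.subperm hsub).perm_of_length_le (by simp)

lemma ext_valAt {p q : CPerm} (hl : p.vals.length = q.vals.length) (ho : p.origin = q.origin)
    (hv : ∀ i, i < p.vals.length → p.valAt i = q.valAt i) : p = q := by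
  obtain ⟨a, b⟩ := p
  obtain ⟨c, d⟩ := q
  simp only at hl ho
  subst ho
  congr 1
  apply List.ext_getElem hl
  intro i h1 h2
  have := hv i h1
  rwa [valAt_eq _ i h1, valAt_eq _ i h2] at this

/-- The value shift used in the box-sum. -/
def shf (v N u : ℕ) : ℕ := if u < v then u else u + (N - 1)

lemma boxSum_length (p q : CPerm) (hq : q.origin < q.vals.length) :
    (boxSum p q).vals.length = p.vals.length + (q.vals.length - 1) := by
  simp [boxSum]; omega

lemma boxSum_origin (p q : CPerm) : (boxSum p q).origin = q.origin + p.origin := rfl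

lemma boxSum_lo (p q : CPerm) (hq : q.origin < q.vals.length) (i : ℕ) (hi : i < q.origin) :
    (boxSum p q).valAt i = shf q.originVal p.vals.length (q.valAt i) := by
  have h1 : i < (boxSum p q).vals.length := by rw [boxSum_length p q hq]; omega
  rw [valAt_eq _ _ h1, valAt_eq q i (by omega)]
  simp only [boxSum, shf]
  rw [List.getElem_append_left (by simp; omega), List.getElem_append_left (by simp; omega)]
  simp

lemma boxSum_mid (p q : CPerm) (hq : q.origin < q.vals.length) (i : ℕ)
    (hi : i < p.vals.length) :
    (boxSum p q).valAt (q.origin + i) = p.valAt i + q.originVal := by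
  have h1 : q.origin + i < (boxSum p q).vals.length := by rw [boxSum_length p q hq]; omega
  rw [valAt_eq _ _ h1, valAt_eq p i (by omega)]
  simp only [boxSum]
  rw [List.getElem_append_left (by simp; omega), List.getElem_append_right (by simp)]
  simp [min_eq_left hq.le]

lemma boxSum_hi (p q : CPerm) (hq : q.origin < q.vals.length) (hp : 0 < p.vals.length) (i : ℕ)
    (hi : q.origin < i) (hi2 : i < q.vals.length) :
    (boxSum p q).valAt (i + (p.vals.length - 1)) = shf q.originVal p.vals.length (q.valAt i) := by
  have h1 : i + (p.vals.length - 1) < (boxSum p q).vals.length := by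
    rw [boxSum_length p q hq]; omega
  rw [valAt_eq _ _ h1, valAt_eq q i (by omega)]
  simp only [boxSum, shf]
  rw [List.getElem_append_right (by simp; omega)]
  simp only [List.getElem_map, List.getElem_drop, List.length_append, List.length_map,
    List.length_take, min_eq_left hq.le]
  have : q.origin + 1 + (i + (p.vals.length - 1) - (q.origin + p.vals.length)) = i := by omega
  simp only [this]

lemma boxSum_originVal (p q : CPerm) (hp : p.origin < p.vals.length)
    (hq : q.origin < q.vals.length) :
    (boxSum p q).originVal = p.originVal + q.originVal := by
  rw [originVal, boxSum_origin, boxSum_mid p q hq _ hp]; rfl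

/-- Combined pointwise formula. -/
lemma boxSum_valAt (p q : CPerm) (hq : q.origin < q.vals.length) (hp : 0 < p.vals.length) (i : ℕ)
    (hi : i < p.vals.length + (q.vals.length - 1)) :
    (boxSum p q).valAt i =
      if i < q.origin then shf q.originVal p.vals.length (q.valAt i)
      else if i < q.origin + p.vals.length then p.valAt (i - q.origin) + q.originVal
      else shf q.originVal p.vals.length (q.valAt (i - (p.vals.length - 1))) := by
  split_ifs with h1 h2
  · exact boxSum_lo p q hq i h1
  · have := boxSum_mid p q hq (i - q.origin) (by omega)
    rwa [show q.origin + (i - q.origin) = i by omega] at this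
  · have := boxSum_hi p q hq hp (i - (p.vals.length - 1)) (by omega) (by omega)
    rwa [show i - (p.vals.length - 1) + (p.vals.length - 1) = i by omega] at this

lemma Good.pos {p : CPerm} (h : p.Good) : 0 < p.vals.length := by have := h.org; omega

lemma Good.ov {p : CPerm} (h : p.Good) : p.originVal < p.vals.length := h.lt _ h.org

lemma Good.ne {p : CPerm} (h : p.Good) {i : ℕ} (hi : i < p.vals.length) (hne : i ≠ p.origin) :
    p.valAt i ≠ p.originVal := fun e => hne (h.inj _ _ hi h.org e)

lemma boxSum_good {p q : CPerm} (hp : p.Good) (hq : q.Good) : (boxSum p q).Good := by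
  have hp0 := hp.pos
  have hq0 := hq.pos
  have hpo := hp.org
  have hqo := hq.org
  have hqv := hq.ov
  have key : ∀ i, i < p.vals.length + (q.vals.length - 1) →
      (∃ j, j < q.vals.length ∧ q.valAt j < q.vals.length ∧ q.valAt j ≠ q.originVal ∧
        (boxSum p q).valAt i = shf q.originVal p.vals.length (q.valAt j) ∧
        ((i < q.origin ∧ j = i) ∨ (q.origin < j ∧ i = j + (p.vals.length - 1)))) ∨
      (∃ j, j < p.vals.length ∧ i = q.origin + j ∧ p.valAt j < p.vals.length ∧
        (boxSum p q).valAt i = p.valAt j + q.originVal) := by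
    intro i hi
    rw [boxSum_valAt p q hqo hp0 i hi]
    split_ifs with h1 h2
    · left
      exact ⟨i, by omega, hq.lt _ (by omega), hq.ne (by omega) (by omega), rfl, by omega⟩
    · right
      exact ⟨i - q.origin, by omega, by omega, hp.lt _ (by omega), rfl⟩
    · left
      exact ⟨i - (p.vals.length - 1), by omega, hq.lt _ (by omega),
        hq.ne (by omega) (by omega), rfl, by omega⟩
  refine ⟨?_, ?_, ?_⟩
  · rw [boxSum_length p q hqo, boxSum_origin]; omega
  · intro i hi
    rw [boxSum_length p q hqo] at *
    rcases key i hi with ⟨j, h1, h2, h3, h4, h5⟩ | ⟨j, h1, h2, h3, h4⟩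
    · rw [h4, shf]; split_ifs <;> omega
    · omega
  · intro i i' hi hi' he
    rw [boxSum_length p q hqo] at *
    rcases key i hi with ⟨j, h1, h2, h3, h4, h5⟩ | ⟨j, h1, h2, h3, h4⟩ <;>
    rcases key i' hi' with ⟨j', h1', h2', h3', h4', h5'⟩ | ⟨j', h1', h2', h3', h4'⟩
    · have : q.valAt j = q.valAt j' := by
        rw [h4, h4', shf, shf] at he; split_ifs at he <;> omega
      have := hq.inj _ _ h1 h1' this
      omega
    · rw [h4, h4', shf] at he; split_ifs at he <;> omega
    · rw [h4, h4', shf] at he; split_ifs at he <;> omega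
    · have := hp.inj _ _ h1 h1' (by omega)
      omega

lemma boxSum_trivial (p : CPerm) : boxSum p trivial = p := by
  obtain ⟨v, o⟩ := p
  simp [boxSum, trivial, originVal, valAt]

lemma trivial_good : trivial.Good := by
  refine ⟨by simp [trivial], ?_, ?_⟩
  · intro i hi; simp [trivial] at hi; subst hi; simp [trivial, valAt]
  · intro i j hi hj _; simp [trivial] at hi hj; omega

lemma boxSum_assoc {a b c : CPerm} (ha : a.Good) (hb : b.Good) (hc : c.Good) :
    boxSum (boxSum a b) c = boxSum a (boxSum b c) := by
  have hab := boxSum_good ha hb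
  have hbc := boxSum_good hb hc
  have la := boxSum_length a b hb.org
  have lb := boxSum_length b c hc.org
  have l1 := boxSum_length (boxSum a b) c hc.org
  have l2 := boxSum_length a (boxSum b c) hbc.org
  have ha0 := ha.pos
  have hb0 := hb.pos
  have hc0 := hc.pos
  have hbo := hb.org
  have hco := hc.org
  have hbv := hb.ov
  have hcv := hc.ov
  have o1 := boxSum_origin b c
  have v1 := boxSum_originVal b c hb.org hc.org
  apply ext_valAt
  · omega
  · simp only [boxSum_origin]; omega
  · intro i hi
    rw [boxSum_valAt _ c hc.org hab.pos i (by omega), boxSum_valAt a _ hbc.org ha0 i (by omega),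
      o1, v1, la]
    by_cases h1 : i < c.origin
    · have hx := hc.ne (i := i) (by omega) (by omega)
      rw [if_pos h1, if_pos (by omega), boxSum_lo b c hco i h1]
      simp only [shf]; split_ifs <;> omega
    rw [if_neg h1]
    by_cases h2 : i < c.origin + (a.vals.length + (b.vals.length - 1))
    · rw [if_pos h2, boxSum_valAt a b hbo ha0 _ (by omega)]
      by_cases h3 : i < c.origin + b.origin
      · rw [if_pos (by omega), if_pos h3]
        have := boxSum_mid b c hco (i - c.origin) (by omega)
        rw [show c.origin + (i - c.origin) = i by omega] at this
        rw [this]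
        simp only [shf]; split_ifs <;> omega
      rw [if_neg (by omega), if_neg h3]
      by_cases h4 : i < c.origin + b.origin + a.vals.length
      · rw [if_pos (by omega), if_pos h4, Nat.sub_sub]; omega
      · rw [if_neg (by omega), if_neg h4]
        have := boxSum_mid b c hco (i - c.origin - (a.vals.length - 1)) (by omega)
        rw [show c.origin + (i - c.origin - (a.vals.length - 1)) = i - (a.vals.length - 1) by omega]
          at this
        rw [this]
        simp only [shf]; split_ifs <;> omega
    · rw [if_neg h2, if_neg (by omega), if_neg (by omega)]
      have := boxSum_hi b c hco hb0 (i - (a.vals.length - 1) - (b.vals.length - 1))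
        (by omega) (by omega)
      rw [show i - (a.vals.length - 1) - (b.vals.length - 1) + (b.vals.length - 1)
        = i - (a.vals.length - 1) by omega] at this
      rw [this, show i - (a.vals.length + (b.vals.length - 1) - 1)
        = i - (a.vals.length - 1) - (b.vals.length - 1) by omega]
      have hx := hc.ne (i := i - (a.vals.length - 1) - (b.vals.length - 1)) (by omega) (by omega)
      simp only [shf]; split_ifs <;> omega

/-- Cancellation when the blocks agree. -/
lemma boxSum_cancel {a b a' b' : CPerm} (ha : a.Good) (hb : b.Good) (ha' : a'.Good)
    (hb' : b'.Good) (h : boxSum a b = boxSum a' b') (hl : a.vals.length = a'.vals.length)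
    (ho : b.origin = b'.origin) (hv : b.originVal = b'.originVal) : a = a' ∧ b = b' := by
  have l1 := boxSum_length a b hb.org
  have l2 := boxSum_length a' b' hb'.org
  have ha0 := ha.pos
  have hb0 := hb.pos
  have hb0' := hb'.pos
  have hbo := hb.org
  have hbo' := hb'.org
  have o1 := boxSum_origin a b
  have o2 := boxSum_origin a' b'
  rw [h] at l1 o1
  constructor
  · apply ext_valAt hl (by omega)
    intro i hi
    have e1 := boxSum_mid a b hbo i hi
    have e2 := boxSum_mid a' b' hbo' i (by omega)
    rw [h, ho, e2] at e1
    omega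
  · apply ext_valAt (by omega) ho
    intro i hi
    have sinj : shf b.originVal a.vals.length (b.valAt i)
        = shf b'.originVal a'.vals.length (b'.valAt i) → b.valAt i = b'.valAt i := by
      rw [← hv, ← hl]; simp only [shf]; split_ifs <;> omega
    rcases lt_trichotomy i b.origin with h1 | h1 | h1
    · apply sinj
      rw [← boxSum_lo a b hbo i h1, ← boxSum_lo a' b' hbo' i (by omega), h]
    · subst h1
      have := hv
      rw [originVal, originVal, ← ho] at this
      exact this
    · apply sinj
      rw [← boxSum_hi a b hbo ha0 i h1 hi, ← boxSum_hi a' b' hbo' (by omega) i (by omega) (by omega),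
        h, hl]

end CPerm
namespace CPerm

/-- A block containing the origin: positions `[s,e)` carry values `[v,w)`. -/
structure Blk (p : CPerm) (s e v w : ℕ) : Prop where
  so : s ≤ p.origin
  oe : p.origin < e
  el : e ≤ p.vals.length
  wl : w ≤ p.vals.length
  iff : ∀ i, i < p.vals.length → ((s ≤ i ∧ i < e) ↔ (v ≤ p.valAt i ∧ p.valAt i < w))

lemma Blk.vo {p : CPerm} (hp : p.Good) {s e v w : ℕ} (h : Blk p s e v w) :
    v ≤ p.originVal ∧ p.originVal < w := (h.iff _ hp.org).mp ⟨h.so, h.oe⟩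

lemma Blk.card {p : CPerm} (hp : p.Good) {s e v w : ℕ} (h : Blk p s e v w) :
    e - s = w - v := by
  have hinj : Set.InjOn p.valAt (Finset.range p.vals.length : Finset ℕ) := by
    intro i hi j hj hij
    exact hp.inj i j (by simpa using hi) (by simpa using hj) hij
  have himg : (Finset.range p.vals.length).image p.valAt = Finset.range p.vals.length := by
    apply Finset.eq_of_subset_of_card_le
    · intro x hx
      obtain ⟨i, hi, rfl⟩ := Finset.mem_image.mp hx
      exact Finset.mem_range.mpr (hp.lt i (Finset.mem_range.mp hi))
    · rw [Finset.card_image_of_injOn hinj]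
  have hI : (Finset.Ico s e).image p.valAt = Finset.Ico v w := by
    ext x
    simp only [Finset.mem_image, Finset.mem_Ico]
    constructor
    · rintro ⟨i, hi, rfl⟩
      exact (h.iff i (by have := h.el; omega)).mp hi
    · intro hx
      have : x ∈ (Finset.range p.vals.length).image p.valAt := by
        rw [himg]; have := h.wl; simp; omega
      obtain ⟨i, hi, rfl⟩ := Finset.mem_image.mp this
      exact ⟨i, (h.iff i (Finset.mem_range.mp hi)).mpr hx, rfl⟩
  have h1 : ((Finset.Ico s e).image p.valAt).card = (Finset.Ico s e).card := by
    apply Finset.card_image_of_injOn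
    apply hinj.mono
    intro i hi
    have := h.el
    simp at hi ⊢
    omega
  rw [hI] at h1
  simpa using h1.symm

lemma Blk.inter {p : CPerm} {s e v w s' e' v' w' : ℕ} (h : Blk p s e v w)
    (h' : Blk p s' e' v' w') : Blk p (max s s') (min e e') (max v v') (min w w') := by
  obtain ⟨a, b, c, d, f⟩ := h
  obtain ⟨a', b', c', d', f'⟩ := h'
  refine ⟨by omega, by omega, by omega, by omega, ?_⟩
  intro i hi
  have := f i hi
  have := f' i hi
  omega

lemma boxSum_blk {a b : CPerm} (ha : a.Good) (hb : b.Good) :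
    Blk (boxSum a b) b.origin (b.origin + a.vals.length) b.originVal
      (b.originVal + a.vals.length) := by
  have hao := ha.org
  have hbo := hb.org
  have hbv := hb.ov
  have ll := boxSum_length a b hbo
  refine ⟨by rw [boxSum_origin]; omega, by rw [boxSum_origin]; omega, by omega, by omega, ?_⟩
  intro i hi
  rw [boxSum_valAt a b hbo ha.pos i (by omega)]
  split_ifs with h1 h2
  · have := hb.ne (i := i) (by omega) (by omega)
    simp only [shf]; split_ifs <;> omega
  · have := ha.lt (i - b.origin) (by omega)
    omega
  · have := hb.ne (i := i - (a.vals.length - 1)) (by omega) (by omega)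
    simp only [shf]; split_ifs <;> omega

lemma valAt_range_map (n o : ℕ) (f : ℕ → ℕ) (i : ℕ) (hi : i < n) :
    valAt ⟨(List.range n).map f, o⟩ i = f i := by
  rw [valAt_eq _ _ (by simpa using hi)]; simp

/-- Every block gives a box-sum decomposition. -/
lemma Blk.split {p : CPerm} (hp : p.Good) {s e v w : ℕ} (h : Blk p s e v w) :
    ∃ x c : CPerm, x.Good ∧ c.Good ∧ boxSum x c = p ∧ x.vals.length = e - s ∧
      c.vals.length = p.vals.length - (e - s) + 1 ∧ c.origin = s ∧ c.originVal = v ∧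
      x.origin = p.origin - s ∧ ∀ i, i < e - s → x.valAt i = p.valAt (i + s) - v := by
  have hc := h.card hp
  obtain ⟨hv1, hv2⟩ := h.vo hp
  obtain ⟨h1, h2, h3, h4, h5⟩ := h
  obtain ⟨x, hx⟩ : ∃ x : CPerm, x = ⟨(List.range (e - s)).map (fun i => p.valAt (i + s) - v),
    p.origin - s⟩ := ⟨_, rfl⟩
  obtain ⟨f, hf⟩ : ∃ f : ℕ → ℕ, f = fun i =>
      if i < s then (if p.valAt i < v then p.valAt i else p.valAt i - (e - s - 1))
      else if i = s then v
      else (if p.valAt (i + (e - s - 1)) < v then p.valAt (i + (e - s - 1))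
        else p.valAt (i + (e - s - 1)) - (e - s - 1)) := ⟨_, rfl⟩
  obtain ⟨c, hcc⟩ : ∃ c : CPerm, c =
    ⟨(List.range (p.vals.length - (e - s) + 1)).map f, s⟩ := ⟨_, rfl⟩
  have xl : x.vals.length = e - s := by rw [hx]; simp
  have xo : x.origin = p.origin - s := by rw [hx]
  have cl : c.vals.length = p.vals.length - (e - s) + 1 := by rw [hcc]; simp
  have co : c.origin = s := by rw [hcc]
  have xv : ∀ i, i < e - s → x.valAt i = p.valAt (i + s) - v := by
    intro i hi; rw [hx, valAt_range_map _ _ _ _ hi]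
  have cv : ∀ i, i < p.vals.length - (e - s) + 1 → c.valAt i = f i := by
    intro i hi; rw [hcc, valAt_range_map _ _ _ _ hi]
  have cov : c.originVal = v := by
    rw [originVal, co, cv s (by omega), hf]; simp
  have clo : ∀ i, i < s → (p.valAt i < v ∧ c.valAt i = p.valAt i) ∨
      (w ≤ p.valAt i ∧ c.valAt i = p.valAt i - (e - s - 1)) := by
    intro i hi
    have := h5 i (by omega)
    rw [cv i (by omega), hf]; simp only [if_pos hi]
    split_ifs <;> omega
  have chi : ∀ i, s < i → i < p.vals.length - (e - s) + 1 →
      (p.valAt (i + (e - s - 1)) < v ∧ c.valAt i = p.valAt (i + (e - s - 1))) ∨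
      (w ≤ p.valAt (i + (e - s - 1)) ∧
        c.valAt i = p.valAt (i + (e - s - 1)) - (e - s - 1)) := by
    intro i hi hi2
    have := h5 (i + (e - s - 1)) (by omega)
    rw [cv i (by omega), hf]; simp only
    rw [if_neg (by omega), if_neg (by omega)]
    split_ifs <;> omega
  have xg : x.Good := by
    refine ⟨by omega, ?_, ?_⟩
    · intro i hi
      have := h5 (i + s) (by omega)
      rw [xv i (by omega)]; omega
    · intro i j hi hj hij
      have := h5 (i + s) (by omega)
      have := h5 (j + s) (by omega)
      rw [xv i (by omega), xv j (by omega)] at hij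
      have := hp.inj (i + s) (j + s) (by omega) (by omega) (by omega)
      omega
  have call : ∀ i, i < c.vals.length → (i = s ∧ c.valAt i = v) ∨
      ∃ j, j < p.vals.length ∧ ((j = i ∧ i < s) ∨ (s < i ∧ j = i + (e - s - 1))) ∧
      p.valAt j < p.vals.length ∧
      ((p.valAt j < v ∧ c.valAt i = p.valAt j) ∨
       (w ≤ p.valAt j ∧ c.valAt i = p.valAt j - (e - s - 1))) := by
    intro i hi
    rcases lt_trichotomy i s with hh | hh | hh
    · right
      exact ⟨i, by omega, by omega, hp.lt _ (by omega), clo i hh⟩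
    · left
      refine ⟨hh, ?_⟩
      rw [hh, ← co]; exact cov
    · right
      exact ⟨i + (e - s - 1), by omega, by omega, hp.lt _ (by omega), chi i hh (by omega)⟩
  have cg : c.Good := by
    refine ⟨by omega, ?_, ?_⟩
    · intro i hi
      rcases call i hi with ⟨_, _⟩ | ⟨j, _, _, _, _⟩ <;> omega
    · intro i i' hi hi' hii
      rcases call i hi with ⟨_, _⟩ | ⟨j, q1, q2, q3, q4⟩ <;>
      rcases call i' hi' with ⟨_, _⟩ | ⟨j', q1', q2', q3', q4'⟩
      · omega
      · omega
      · omega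
      · have := hp.inj j j' q1 q1' (by omega)
        omega
  refine ⟨x, c, xg, cg, ?_, xl, cl, co, cov, xo, xv⟩
  have ll := boxSum_length x c cg.org
  apply ext_valAt (by omega) (by rw [boxSum_origin]; omega)
  intro i hi
  rw [boxSum_valAt x c cg.org xg.pos i (by omega), xl, co, cov]
  split_ifs with g1 g2
  · have := clo i g1
    simp only [shf]; split_ifs <;> omega
  · have := h5 i (by omega)
    rw [xv _ (by omega), show i - s + s = i by omega]; omega
  · have := chi (i - (e - s - 1)) (by omega) (by omega)
    rw [show i - (e - s - 1) + (e - s - 1) = i by omega] at this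
    simp only [shf]; split_ifs <;> omega

/-- Sub-blocks of the inner factor. -/
lemma Blk.inner {a b : CPerm} (ha : a.Good) (hb : b.Good) {s e v w : ℕ}
    (h : Blk (boxSum a b) s e v w) (hs : b.origin ≤ s) (he : e ≤ b.origin + a.vals.length)
    (hw : w ≤ b.originVal + a.vals.length) (hv : b.originVal ≤ v) :
    Blk a (s - b.origin) (e - b.origin) (v - b.originVal) (w - b.originVal) := by
  have hbo := hb.org
  have l := boxSum_length a b hbo
  obtain ⟨h1, h2, h3, h4, h5⟩ := h
  rw [boxSum_origin] at h1 h2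
  refine ⟨by omega, by omega, by omega, by omega, ?_⟩
  intro i hi
  have := h5 (b.origin + i) (by omega)
  rw [boxSum_mid a b hbo i hi] at this
  omega

/-- An indecomposable inner factor has only two blocks. -/
lemma indec_blk {a : CPerm} (ha : a.Good) (hi : a.BoxIndecomposable) {s e v w : ℕ}
    (h : Blk a s e v w) : e - s = 1 ∨ e - s = a.vals.length := by
  obtain ⟨x, c, hx, hc, hs, lx, lc, -⟩ := h.split ha
  have := h.el
  have := h.so
  have := h.oe
  by_contra hcon
  apply hi.2
  refine ⟨x, c, (good_iff x).mpr hx, (good_iff c).mpr hc, ?_, ?_, hs⟩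
  · rw [len]; omega
  · rw [len]; omega

lemma oneQ1 {a : CPerm} (ha : a.Good) (h : a.origin = 0) (h' : a.originVal = 0) :
    OneQuadrant a 1 := by
  intro i hi hne
  have := ha.ne hi hne
  exact ⟨hi, hne, Or.inl ⟨rfl, by omega, by omega⟩⟩

lemma oneQ2 {a : CPerm} (ha : a.Good) (h : a.origin + 1 = a.vals.length) (h' : a.originVal = 0) :
    OneQuadrant a 2 := by
  intro i hi hne
  have := ha.ne hi hne
  exact ⟨hi, hne, Or.inr (Or.inl ⟨rfl, by omega, by omega⟩)⟩

lemma oneQ3 {a : CPerm} (ha : a.Good) (h : a.origin + 1 = a.vals.length)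
    (h' : a.originVal + 1 = a.vals.length) : OneQuadrant a 3 := by
  intro i hi hne
  have := ha.ne hi hne
  have := ha.lt i hi
  exact ⟨hi, hne, Or.inr (Or.inr (Or.inl ⟨rfl, by omega, by omega⟩))⟩

lemma oneQ4 {a : CPerm} (ha : a.Good) (h : a.origin = 0)
    (h' : a.originVal + 1 = a.vals.length) : OneQuadrant a 4 := by
  intro i hi hne
  have := ha.ne hi hne
  have := ha.lt i hi
  exact ⟨hi, hne, Or.inr (Or.inr (Or.inr ⟨rfl, by omega, by omega⟩))⟩

lemma comm13 {a b : CPerm} (ha : a.Good) (hb : b.Good) (h1 : a.origin = 0)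
    (h2 : a.originVal = 0) (h3 : b.origin + 1 = b.vals.length)
    (h4 : b.originVal + 1 = b.vals.length) : boxSum a b = boxSum b a := by
  have la := boxSum_length a b hb.org
  have lb := boxSum_length b a ha.org
  have ha0 := ha.pos
  have hb0 := hb.pos
  apply ext_valAt (by omega) (by simp only [boxSum_origin]; omega)
  intro i hi
  rw [boxSum_valAt a b hb.org ha.pos i (by omega), boxSum_valAt b a ha.org hb.pos i (by omega)]
  rcases lt_trichotomy i b.origin with h | h | h
  · have := hb.ne (i := i) (by omega) (by omega)
    have := hb.lt i (by omega)
    rw [if_pos h, if_neg (by omega), if_pos (by omega), h1, h2, shf, if_pos (by omega)]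
    simp
  · rw [if_neg (by omega), if_pos (by omega), if_neg (by omega), if_pos (by omega)]
    rw [h, h1, Nat.sub_self, Nat.sub_zero]
    change a.valAt 0 + b.originVal = b.originVal + a.originVal
    rw [← h1]; exact Nat.add_comm _ _
  · rw [if_neg (by omega), if_pos (by omega), if_neg (by omega), if_neg (by omega), h2, shf,
      if_neg (by omega), show i - b.origin = i - (b.vals.length - 1) by omega]
    omega

lemma comm24 {a b : CPerm} (ha : a.Good) (hb : b.Good) (h1 : a.origin = 0)
    (h2 : a.originVal + 1 = a.vals.length) (h3 : b.origin + 1 = b.vals.length)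
    (h4 : b.originVal = 0) : boxSum a b = boxSum b a := by
  have la := boxSum_length a b hb.org
  have lb := boxSum_length b a ha.org
  have ha0 := ha.pos
  have hb0 := hb.pos
  apply ext_valAt (by omega) (by simp only [boxSum_origin]; omega)
  intro i hi
  rw [boxSum_valAt a b hb.org ha.pos i (by omega), boxSum_valAt b a ha.org hb.pos i (by omega)]
  rcases lt_trichotomy i b.origin with h | h | h
  · rw [if_pos h, if_neg (by omega), if_pos (by omega), h1, h4, shf, if_neg (by omega)]
    simp; omega
  · rw [if_neg (by omega), if_pos (by omega), if_neg (by omega), if_pos (by omega)]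
    rw [h, h1, Nat.sub_self, Nat.sub_zero]
    change a.valAt 0 + b.originVal = b.originVal + a.originVal
    rw [← h1]; exact Nat.add_comm _ _
  · have := ha.ne (i := i - (b.vals.length - 1)) (by omega) (by omega)
    have := ha.lt (i - (b.vals.length - 1)) (by omega)
    rw [if_neg (by omega), if_pos (by omega), if_neg (by omega), if_neg (by omega), h4, shf,
      if_pos (by omega), show i - b.origin = i - (b.vals.length - 1) by omega]
    omega

lemma CommutingPair.symm {a b : CPerm} (h : CommutingPair a b) : CommutingPair b a := by
  obtain ⟨q, r, h1, h2, h3⟩ := h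
  refine ⟨r, q, ?_, h3, h2⟩
  unfold OppositeQuadrants at *
  omega

lemma arith_one {s N s' N' o x x' : ℕ} (h1 : o = s + x) (h2 : o = s' + x') (h3 : x < N)
    (h4 : x' < N') (h5 : 2 ≤ N) (h6 : 2 ≤ N')
    (h : min (s + N) (s' + N') - max s s' = 1) :
    (x = 0 ∧ x' + 1 = N') ∨ (x' = 0 ∧ x + 1 = N) := by
  omega

lemma arith_eq {s N s' N' : ℕ} (h5 : 2 ≤ N) (h : min (s + N) (s' + N') - max s s' = N)
    (h' : min (s + N) (s' + N') - max s s' = N') : N = N' ∧ s = s' := by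
  omega

/-- The key exchange lemma. -/
lemma exchange {a b a' b' : CPerm} (ha : a.Good) (hb : b.Good) (ha' : a'.Good) (hb' : b'.Good)
    (ia : a.BoxIndecomposable) (ia' : a'.BoxIndecomposable) (h : boxSum a b = boxSum a' b') :
    (a = a' ∧ b = b') ∨
    (CommutingPair a a' ∧ ∃ c : CPerm, c.Good ∧ b = boxSum a' c ∧ b' = boxSum a c) := by
  have hI := boxSum_blk ha hb
  have hI' := boxSum_blk ha' hb'
  rw [← h] at hI'
  have hpg := boxSum_good ha hb
  have hJ := hI.inter hI'
  have ho := boxSum_origin a b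
  have ho' := boxSum_origin a' b'
  rw [← h] at ho'
  have hov := boxSum_originVal a b ha.org hb.org
  have hov' := boxSum_originVal a' b' ha'.org hb'.org
  rw [← h] at hov'
  have hl := boxSum_length a b hb.org
  have hl' := boxSum_length a' b' hb'.org
  rw [← h] at hl'
  have cJ := hJ.card hpg
  have vJ := hJ.vo hpg
  have dA := indec_blk ha ia (hJ.inner ha hb (by omega) (by omega) (by omega) (by omega))
  have hJ2 := hJ
  rw [h] at hJ2
  have dA' := indec_blk ha' ia'
    (hJ2.inner ha' hb' (by omega) (by omega) (by omega) (by omega))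
  have na := ia.1
  have na' := ia'.1
  rw [len] at na na'
  have hao := ha.org
  have hao' := ha'.org
  have hav := ha.ov
  have hav' := ha'.ov
  have hbo := hb.org
  have hbo' := hb'.org
  have hbv := hb.ov
  have hbv' := hb'.ov
  by_cases hcase : a.vals.length = a'.vals.length ∧ b.origin = b'.origin ∧
      b.originVal = b'.originVal
  · left
    exact boxSum_cancel ha hb ha' hb' h hcase.1 hcase.2.1 hcase.2.2
  right
  rw [Nat.sub_sub_sub_cancel_right (by omega)] at dA dA'
  have hone : min (b.origin + a.vals.length) (b'.origin + a'.vals.length) -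
      max b.origin b'.origin = 1 := by
    rcases dA with dA | dA
    · exact dA
    rcases dA' with dA' | dA'
    · exact dA'
    exfalso
    apply hcase
    have r1 := arith_eq (by omega) dA dA'
    have r2 := arith_eq (by omega) (cJ ▸ dA) (cJ ▸ dA')
    exact ⟨r1.1, r1.2, r2.2⟩
  have hone' := hone
  rw [cJ] at hone'
  have posn := arith_one ho ho' hao hao' (by omega) (by omega) hone
  have valn := arith_one (hov.trans (Nat.add_comm _ _)) (hov'.trans (Nat.add_comm _ _)) hav hav'
    (by omega) (by omega) hone'
  clear cJ vJ dA dA' hcase hone hone' hJ hJ2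
  have hcp : CommutingPair a a' ∧ boxSum a a' = boxSum a' a := by
    rcases posn with ⟨p1, p2⟩ | ⟨p1, p2⟩ <;> rcases valn with ⟨v1, v2⟩ | ⟨v1, v2⟩
    · exact ⟨⟨1, 3, by simp [OppositeQuadrants], oneQ1 ha p1 v1, oneQ3 ha' p2 v2⟩,
        comm13 ha ha' p1 v1 p2 v2⟩
    · exact ⟨⟨4, 2, by simp [OppositeQuadrants], oneQ4 ha p1 v2, oneQ2 ha' p2 v1⟩,
        comm24 ha ha' p1 v2 p2 v1⟩
    · exact ⟨⟨2, 4, by simp [OppositeQuadrants], oneQ2 ha p2 v1, oneQ4 ha' p1 v2⟩,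
        (comm24 ha' ha p1 v2 p2 v1).symm⟩
    · exact ⟨⟨3, 1, by simp [OppositeQuadrants], oneQ3 ha p2 v2, oneQ1 ha' p1 v1⟩,
        (comm13 ha' ha p1 v1 p2 v2).symm⟩
  refine ⟨hcp.1, ?_⟩
  have hB : Blk b (b.origin - a'.origin) (b.origin - a'.origin + a'.vals.length)
      (b.originVal - a'.originVal) (b.originVal - a'.originVal + a'.vals.length) := by
    refine ⟨by omega, by omega, by omega, by omega, ?_⟩
    intro i hi
    rcases lt_trichotomy i b.origin with g | g | g
    · have q := hI'.iff i (by omega)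
      rw [boxSum_lo a b hbo i g] at q
      have := hb.ne (i := i) (by omega) (by omega)
      simp only [shf] at q
      split_ifs at q <;> omega
    · subst g
      change _ ↔ (_ ≤ b.originVal ∧ b.originVal < _)
      omega
    · have q := hI'.iff (i + (a.vals.length - 1)) (by omega)
      rw [boxSum_hi a b hbo ha.pos i g hi] at q
      have := hb.ne (i := i) (by omega) (by omega)
      simp only [shf] at q
      split_ifs at q <;> omega
  obtain ⟨x, c, hx, hc, hs, lx, lc, co, cv, xo, xv⟩ := hB.split hb
  have hxa : x = a' := by
    apply ext_valAt (by omega) (by omega)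
    intro i hi
    rw [xv i (by omega)]
    have m := boxSum_mid a' b' hbo' i (by omega)
    rw [← h] at m
    have hlt := ha'.lt i (by omega)
    rcases lt_trichotomy (i + (b.origin - a'.origin)) b.origin with g | g | g
    · rw [show b'.origin + i = i + (b.origin - a'.origin) by omega,
        boxSum_lo a b hbo _ g, shf] at m
      have := hb.ne (i := i + (b.origin - a'.origin)) (by omega) (by omega)
      have := ha'.ne (i := i) (by omega) (by omega)
      split_ifs at m <;> omega
    · rw [g]
      change b.originVal - _ = _
      rw [show i = a'.origin by omega]
      change b.originVal - _ = a'.originVal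
      omega
    · rw [show b'.origin + i = i + (b.origin - a'.origin) + (a.vals.length - 1) by omega,
        boxSum_hi a b hbo ha.pos _ g (by omega), shf] at m
      have := hb.ne (i := i + (b.origin - a'.origin)) (by omega) (by omega)
      have := ha'.ne (i := i) (by omega) (by omega)
      split_ifs at m <;> omega
  subst hxa
  refine ⟨c, hc, hs.symm, ?_⟩
  have e : boxSum x (boxSum a c) = boxSum x b' := by
    rw [← h, ← hs, ← boxSum_assoc hx ha hc, ← boxSum_assoc ha hx hc, hcp.2]
  refine (boxSum_cancel hx (boxSum_good ha hc) hx hb' e rfl ?_ ?_).2.symm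
  · rw [boxSum_origin]; omega
  · rw [boxSum_originVal a c hao hc.org]; omega

lemma exists_list (n : ℕ) : ∀ p : CPerm, p.Good → p.vals.length ≤ n →
    ∃ l : List CPerm, (∀ σ ∈ l, σ.IsValid ∧ σ.BoxIndecomposable) ∧ boxSumList l = p := by
  induction n with
  | zero => intro p hp h; have := hp.pos; omega
  | succ n ih =>
    intro p hp h
    by_cases h1 : p.vals.length = 1
    · refine ⟨[], by simp, ?_⟩
      have := hp.org
      change trivial = p
      apply ext_valAt
      · rw [h1]; rfl
      · change 0 = _; omega
      · intro i hi
        simp [trivial] at hi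
        subst hi
        have := hp.lt 0 (by omega)
        change 0 = _
        omega
    · have hp0 := hp.pos
      -- choose the inner factor of minimal size
      have hex : ∃ m, ∃ a b : CPerm, a.Good ∧ b.Good ∧ 2 ≤ a.vals.length ∧ boxSum a b = p ∧
          a.vals.length = m :=
        ⟨_, p, trivial, hp, trivial_good, by omega, boxSum_trivial p, rfl⟩
      classical
      obtain ⟨a, b, ha, hb, h2, hab, hm⟩ := Nat.find_spec hex
      have hmin := fun {k : ℕ} => Nat.find_min (m := k) hex
      have hl := boxSum_length a b hb.org
      have hb0 := hb.pos
      rw [hab] at hl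
      have ia : a.BoxIndecomposable := by
        refine ⟨by rw [len]; omega, ?_⟩
        rintro ⟨c, d, hc, hd, c1, d1, e⟩
        rw [good_iff] at hc hd
        rw [len] at c1 d1
        have hl2 := boxSum_length c d hd.org
        rw [e] at hl2
        apply hmin (k := c.vals.length) (by omega)
        refine ⟨c, boxSum d b, hc, boxSum_good hd hb, by omega, ?_, rfl⟩
        rw [← boxSum_assoc hc hd hb, e, hab]
      obtain ⟨l, hl1, hl2⟩ := ih b hb (by omega)
      refine ⟨a :: l, ?_, ?_⟩
      · intro σ hσ
        rcases List.mem_cons.mp hσ with rfl | hσ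
        · exact ⟨(good_iff _).mpr ha, ia⟩
        · exact hl1 σ hσ
      · change boxSum a (boxSumList l) = p
        rw [hl2, hab]

lemma boxSumList_good (l : List CPerm) (h : ∀ σ ∈ l, σ.IsValid ∧ σ.BoxIndecomposable) :
    (boxSumList l).Good := by
  induction l with
  | nil => exact trivial_good
  | cons a t ih =>
    exact boxSum_good ((good_iff a).mp (h a (by simp)).1) (ih fun σ hσ => h σ (by simp [hσ]))

lemma commStep_cons (a : CPerm) {l l' : List CPerm} (h : CommStep l l') :
    CommStep (a :: l) (a :: l') := by
  obtain ⟨pre, post, x, y, hc, rfl, rfl⟩ := h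
  exact ⟨a :: pre, post, x, y, hc, rfl, rfl⟩

lemma rtg_cons (a : CPerm) {l l' : List CPerm} (h : Relation.ReflTransGen CommStep l l') :
    Relation.ReflTransGen CommStep (a :: l) (a :: l') :=
  Relation.ReflTransGen.lift (fun t => a :: t) (fun _ _ => commStep_cons a) _ _ h

lemma unique_list (n : ℕ) : ∀ l l' : List CPerm,
    (∀ σ ∈ l, σ.IsValid ∧ σ.BoxIndecomposable) → (∀ σ ∈ l', σ.IsValid ∧ σ.BoxIndecomposable) →
    boxSumList l = boxSumList l' → (boxSumList l).vals.length ≤ n →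
    Relation.ReflTransGen CommStep l l' := by
  induction n with
  | zero => intro l l' h _ _ hn; have := (boxSumList_good l h).pos; omega
  | succ n ih =>
    have tl : ∀ (a : CPerm) (t : List CPerm), (∀ σ ∈ a :: t, σ.IsValid ∧ σ.BoxIndecomposable) →
        (boxSumList t).vals.length < (boxSumList (a :: t)).vals.length := by
      intro a t h
      have hg := boxSumList_good t (fun σ hσ => h σ (by simp [hσ]))
      have := hg.pos
      have h1 := (h a (by simp)).2.1
      rw [len] at h1
      change _ < (boxSum a (boxSumList t)).vals.length
      rw [boxSum_length _ _ hg.org]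
      omega
    have nil_len : (boxSumList []).vals.length = 1 := rfl
    intro l l' h h' he hn
    match l, l' with
    | [], [] => exact .refl
    | [], a :: t =>
      have := tl a t h'
      have := (boxSumList_good t (fun σ hσ => h' σ (by simp [hσ]))).pos
      rw [← he, nil_len] at *
      omega
    | a :: t, [] =>
      have := tl a t h
      have := (boxSumList_good t (fun σ hσ => h σ (by simp [hσ]))).pos
      rw [he, nil_len] at *
      omega
    | a :: t, a' :: t' =>
      have lt := tl a t h
      have lt' := tl a' t' h'
      have ht : ∀ σ ∈ t, σ.IsValid ∧ σ.BoxIndecomposable := fun σ hσ => h σ (by simp [hσ])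
      have ht' : ∀ σ ∈ t', σ.IsValid ∧ σ.BoxIndecomposable := fun σ hσ => h' σ (by simp [hσ])
      obtain ⟨va, ia⟩ := h a (by simp)
      obtain ⟨va', ia'⟩ := h' a' (by simp)
      have hn' := hn
      rw [he] at hn'
      rcases exchange ((good_iff a).mp va) (boxSumList_good t ht) ((good_iff a').mp va')
        (boxSumList_good t' ht') ia ia' he with ⟨rfl, e⟩ | ⟨hc, c, hcg, e1, e2⟩
      · exact rtg_cons a (ih t t' ht ht' e (by omega))
      · obtain ⟨u, hu, rfl⟩ := exists_list _ c hcg le_rfl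
        have s1 := ih t (a' :: u) ht (by
          intro σ hσ
          rcases List.mem_cons.mp hσ with rfl | hσ
          · exact ⟨va', ia'⟩
          · exact hu σ hσ) e1 (by omega)
        have s2 := ih (a :: u) t' (by
          intro σ hσ
          rcases List.mem_cons.mp hσ with rfl | hσ
          · exact ⟨va, ia⟩
          · exact hu σ hσ) ht' e2.symm (by rw [show boxSumList (a :: u) = _ from e2.symm]; omega)
        refine (rtg_cons a s1).trans (.trans (.single ?_) (rtg_cons a' s2))
        exact ⟨[], u, a, a', hc, rfl, rfl⟩

lemma rtg_perm {l l' : List CPerm} (h : Relation.ReflTransGen CommStep l l') : l'.Perm l := by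
  induction h with
  | refl => exact List.Perm.refl _
  | tail _ hs ih =>
    obtain ⟨pre, post, x, y, _, rfl, rfl⟩ := hs
    exact ((List.Perm.swap x y post).append_left pre).trans ih

end CPerm

/-- Every centred permutation decomposes as a box-sum of
⊞-indecomposables, uniquely up to transposing adjacent commuting pairs; in
particular the number of factors and the multiset of factors are determined. -/
theorem boxSum_decomposition_unique (p : CPerm) (hp : p.IsValid) :
    ∃ l : List CPerm,
      (∀ σ ∈ l, σ.IsValid ∧ σ.BoxIndecomposable) ∧ CPerm.boxSumList l = p ∧
      ∀ l' : List CPerm, (∀ σ ∈ l', σ.IsValid ∧ σ.BoxIndecomposable) →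
        CPerm.boxSumList l' = p →
          l'.length = l.length ∧ (l' : Multiset CPerm) = (l : Multiset CPerm) ∧
            Relation.ReflTransGen CPerm.CommStep l l' := by
  rw [CPerm.good_iff] at hp
  obtain ⟨l, hl, rfl⟩ := CPerm.exists_list _ p hp le_rfl
  refine ⟨l, hl, rfl, fun l' hl' e => ?_⟩
  have h := CPerm.unique_list _ l l' hl hl' e.symm le_rfl
  have hperm := CPerm.rtg_perm h
  exact ⟨hperm.length_eq, Multiset.coe_eq_coe.mpr hperm, h⟩
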